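/- arXiv:2409.11078 — 7 statements merged into one kernel-verified Lean document; each statement's English description precedes it below -/
import Mathlib

section
/- Let a < b be real numbers and y_a, y_b, m_a, m_b ∈ ℝ with y_a = y_b (so the secant slope d = 0), and let p be the cubic Hermite interpolant on [a,b] of this data. Then p is monotonic on [a,b] (monotonically increasing or monotonically decreasing on [a,b]) if and only if m_a = 0 and m_b = 0; moreover, in that case p is constant on [a,b], with p(x) = y_a for all x ∈ [a,b]. -/
/-- The cubic Hermite interpolant on `[a,b]` of data `y_a, y_b, m_a, m_b`. -/
noncomputable def hermite (a b ya yb ma mb : ℝ) : ℝ → ℝ := fun x =>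
  let t := (x - a) / (b - a)
  (2 * t ^ 3 - 3 * t ^ 2 + 1) * ya
    + (t ^ 3 - 2 * t ^ 2 + t) * (b - a) * ma
    + (-2 * t ^ 3 + 3 * t ^ 2) * yb
    + (t ^ 3 - t ^ 2) * (b - a) * mb

/-- With equal end values, the interpolant in the normalized coordinate `t`. -/
theorem hermite_add_mul_of_eq {a b : ℝ} (hab : a < b) (y ma mb t : ℝ) :
    hermite a b y y ma mb (a + t * (b - a)) =
      y + (b - a) * (t * (1 - t) * ((1 - t) * ma - t * mb)) := by
  have hb : b - a ≠ 0 := (sub_pos.2 hab).ne'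
  have ht : (a + t * (b - a) - a) / (b - a) = t := by
    rw [add_sub_cancel_left, mul_div_cancel_right₀ _ hb]
  simp only [hermite, ht]
  ring

/-- If the interpolant of data with equal end values is constant on `[a,b]`,
both end slopes vanish. -/
theorem slopes_eq_zero_of_hermite_const {a b y ma mb : ℝ} (hab : a < b)
    (h : ∀ x ∈ Set.Icc a b, hermite a b y y ma mb x = y) : ma = 0 ∧ mb = 0 := by
  have hb : 0 < b - a := sub_pos.2 hab
  have key (t : ℝ) (h₀ : 0 ≤ t) (h₁ : t ≤ 1) :
      t * (1 - t) * ((1 - t) * ma - t * mb) = 0 := by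
    have hx := h (a + t * (b - a)) ⟨by nlinarith, by nlinarith⟩
    rw [hermite_add_mul_of_eq hab, add_eq_left] at hx
    exact (mul_eq_zero.1 hx).resolve_left hb.ne'
  have h₁ := key (1 / 3) (by norm_num) (by norm_num)
  have h₂ := key (2 / 3) (by norm_num) (by norm_num)
  constructor <;> linarith

/-- If `y_a = y_b` (secant slope `d = 0`), the cubic Hermite interpolant is
monotonic on `[a,b]` if and only if `m_a = 0` and `m_b = 0`; moreover in that
case it is constant on `[a,b]`, equal to `y_a`. -/
theorem hermite_monotone_iff_of_secant_zero (a b ya yb ma mb : ℝ) (hab : a < b)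
    (hy : ya = yb) :
    ((MonotoneOn (hermite a b ya yb ma mb) (Set.Icc a b) ∨
        AntitoneOn (hermite a b ya yb ma mb) (Set.Icc a b)) ↔
      (ma = 0 ∧ mb = 0)) ∧
    ((ma = 0 ∧ mb = 0) → ∀ x ∈ Set.Icc a b, hermite a b ya yb ma mb x = ya) := by
  subst hy
  have const_of_slopes : ma = 0 ∧ mb = 0 →
      ∀ x ∈ Set.Icc a b, hermite a b ya ya ma mb x = ya := by
    rintro ⟨rfl, rfl⟩ x -
    simp only [hermite]
    ring
  have left_value : hermite a b ya ya ma mb a = ya := by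
    simpa using hermite_add_mul_of_eq hab ya ma mb 0
  have right_value : hermite a b ya ya ma mb b = ya := by
    simpa using hermite_add_mul_of_eq hab ya ma mb 1
  have ha : a ∈ Set.Icc a b := Set.left_mem_Icc.2 hab.le
  have hb : b ∈ Set.Icc a b := Set.right_mem_Icc.2 hab.le
  refine ⟨⟨fun h => slopes_eq_zero_of_hermite_const (y := ya) hab fun x hx => ?_,
    fun h => Or.inl ?_⟩, const_of_slopes⟩
  · rcases h with h | h
    · exact le_antisymm ((h hx hb hx.2).trans_eq right_value)
        (left_value.symm.trans_le (h ha hx hx.1))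
    · exact le_antisymm ((h ha hx hx.1).trans_eq left_value)
        (right_value.symm.trans_le (h hx hb hx.2))
  · intro x hx z hz _
    rw [const_of_slopes h x hx, const_of_slopes h z hz]
end

section
/- Let a < b be real numbers and y_a, y_b, m_a, m_b ∈ ℝ with y_a < y_b, and let p be the cubic Hermite interpolant on [a,b] of this data, with secant slope d = (y_b−y_a)/(b−a) > 0. If α := m_a/d ≥ 0, β := m_b/d ≥ 0, and α² + β² ≤ 9, then p is monotonically increasing on [a,b] (i.e., x₁ ≤ x₂ in [a,b] implies p(x₁) ≤ p(x₂)). -/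
/-- The derivative of the normalized Hermite cubic, in Bernstein form, is nonnegative on `[0,1]`. -/
theorem bernstein_quadratic_nonneg {α β s t : ℝ} (hα : 0 ≤ α) (hβ : 0 ≤ β)
    (hsum : α ^ 2 + β ^ 2 ≤ 9) (hs : 0 ≤ s) (ht : 0 ≤ t) :
    0 ≤ α * s ^ 2 + 2 * (3 - α - β) * (s * t) + β * t ^ 2 := by
  rcases le_or_gt (α + β) 3 with h | h
  · have h3 : 0 ≤ 3 - α - β := by linarith
    positivity
  · have hS : α + β ≤ 9 := by nlinarith [sq_nonneg (α - β)]
    have hdisc : (α + β - 3) ^ 2 ≤ α * β := by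
      nlinarith [mul_nonneg (sub_nonneg.2 h.le) (sub_nonneg.2 hS)]
    have hα' : 0 < α := by
      refine hα.lt_of_ne fun h0 => ?_
      subst h0
      nlinarith
    refine nonneg_of_mul_nonneg_right ?_ hα'
    nlinarith [sq_nonneg (α * s - (α + β - 3) * t),
      mul_nonneg (sub_nonneg.2 hdisc) (sq_nonneg t)]

/-- The Hermite cubic on `[0,1]` with values `0, 1` and slopes `α, β` is monotone when
`α, β ≥ 0` and `α² + β² ≤ 9`. -/
theorem monotoneOn_unit_hermite {α β : ℝ} (hα : 0 ≤ α) (hβ : 0 ≤ β)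
    (hsum : α ^ 2 + β ^ 2 ≤ 9) :
    MonotoneOn (fun t : ℝ => (t ^ 3 - 2 * t ^ 2 + t) * α + (-2 * t ^ 3 + 3 * t ^ 2)
      + (t ^ 3 - t ^ 2) * β) (Set.Icc 0 1) := by
  have hderiv (t : ℝ) : HasDerivAt (fun t : ℝ => (t ^ 3 - 2 * t ^ 2 + t) * α
      + (-2 * t ^ 3 + 3 * t ^ 2) + (t ^ 3 - t ^ 2) * β)
      (α * (1 - t) ^ 2 + 2 * (3 - α - β) * ((1 - t) * t) + β * t ^ 2) t := by
    have h2 := hasDerivAt_pow 2 t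
    have h3 := hasDerivAt_pow 3 t
    refine ((((h3.sub (h2.const_mul 2)).add (hasDerivAt_id t)).mul_const α).add
      ((h3.const_mul (-2)).add (h2.const_mul 3))).add ((h3.sub h2).mul_const β)
      |>.congr_deriv ?_
    norm_num
    ring
  refine monotoneOn_of_hasDerivWithinAt_nonneg (convex_Icc 0 1)
    (fun t _ => (hderiv t).continuousAt.continuousWithinAt)
    (fun t _ => (hderiv t).hasDerivWithinAt) fun t ht => ?_
  have ht' := interior_subset ht
  exact bernstein_quadratic_nonneg hα hβ hsum (sub_nonneg.2 ht'.2) ht'.1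

/-- Fritsch–Carlson sufficient conditions for increasing monotonicity: if
`y_a < y_b`, `α = m_a/d ≥ 0`, `β = m_b/d ≥ 0` and `α² + β² ≤ 9`, where
`d = (y_b - y_a)/(b - a)` is the secant slope, then the cubic Hermite
interpolant is monotonically increasing on `[a,b]`. -/
theorem hermite_increasing_sufficient (a b ya yb ma mb : ℝ) (hab : a < b)
    (hy : ya < yb)
    (hα : 0 ≤ ma / ((yb - ya) / (b - a)))
    (hβ : 0 ≤ mb / ((yb - ya) / (b - a)))
    (hsum : (ma / ((yb - ya) / (b - a))) ^ 2
        + (mb / ((yb - ya) / (b - a))) ^ 2 ≤ 9) :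
    ∀ x₁ ∈ Set.Icc a b, ∀ x₂ ∈ Set.Icc a b, x₁ ≤ x₂ →
      hermite a b ya yb ma mb x₁ ≤ hermite a b ya yb ma mb x₂ := by
  intro x₁ hx₁ x₂ hx₂ hx
  have hba : 0 < b - a := sub_pos.2 hab
  have hyy : 0 < yb - ya := sub_pos.2 hy
  have hunit {x : ℝ} (h : x ∈ Set.Icc a b) : (x - a) / (b - a) ∈ Set.Icc (0 : ℝ) 1 :=
    ⟨div_nonneg (sub_nonneg.2 h.1) hba.le, (div_le_one hba).2 (sub_le_sub_right h.2 a)⟩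
  have hmono := monotoneOn_unit_hermite hα hβ hsum (hunit hx₁) (hunit hx₂)
    (div_le_div_of_nonneg_right (sub_le_sub_right hx a) hba.le)
  have hma : (b - a) * ma = (yb - ya) * (ma / ((yb - ya) / (b - a))) := by field_simp
  have hmb : (b - a) * mb = (yb - ya) * (mb / ((yb - ya) / (b - a))) := by field_simp
  simp only [hermite, mul_assoc _ (b - a), hma, hmb]
  have := mul_le_mul_of_nonneg_left hmono hyy.le
  linarith
end

section
/- Let a < b be real numbers and y_a, y_b, m_a, m_b ∈ ℝ with y_a > y_b, and let p be the cubic Hermite interpolant on [a,b] of this data, with secant slope d = (y_b−y_a)/(b−a) < 0. If m_a ≤ 0, m_b ≤ 0, and (m_a/d)² + (m_b/d)² ≤ 9, then p is monotonically decreasing on [a,b] (i.e., x₁ ≤ x₂ in [a,b] implies p(x₁) ≥ p(x₂)). -/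
/-- The Fritsch–Carlson quadratic form is nonnegative on the positive quadrant as soon as
`α, β ≥ 0` and `α² + β² ≤ 9`. -/
theorem fritschCarlson_quadratic_nonneg {α β s t : ℝ} (hα : 0 ≤ α) (hβ : 0 ≤ β)
    (h : α ^ 2 + β ^ 2 ≤ 9) (hs : 0 ≤ s) (ht : 0 ≤ t) :
    0 ≤ α * s ^ 2 + (6 - 2 * α - 2 * β) * (s * t) + β * t ^ 2 := by
  have hst : 0 ≤ s * t := mul_nonneg hs ht
  have hαs : 0 ≤ α * s ^ 2 := by positivity
  have hβt : 0 ≤ β * t ^ 2 := by positivity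
  rcases le_total (α + β) 3 with hle | hge
  · have : 0 ≤ (6 - 2 * α - 2 * β) * (s * t) := mul_nonneg (by linarith) hst
    linarith
  · have hα3 : α ≤ 3 := by nlinarith
    have hβ3 : β ≤ 3 := by nlinarith
    have hdisc : (α + β - 3) ^ 2 ≤ α * β := by
      nlinarith [mul_nonneg (sub_nonneg.2 hge) (by linarith : 0 ≤ 9 - (α + β))]
    have hsq : (2 * (α + β - 3) * (s * t)) ^ 2 ≤ (α * s ^ 2 + β * t ^ 2) ^ 2 := by
      have := mul_le_mul_of_nonneg_right hdisc (sq_nonneg (s * t))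
      nlinarith [sq_nonneg (α * s ^ 2 - β * t ^ 2)]
    have := (abs_le_of_sq_le_sq' hsq (by positivity)).2
    linarith

/-- The derivative of the cubic Hermite interpolant, in terms of `t = (x - a) / (b - a)`. -/
theorem hasDerivAt_hermite {a b : ℝ} (hab : a ≠ b) (ya yb ma mb x : ℝ) :
    HasDerivAt (hermite a b ya yb ma mb)
      (ma * (1 - (x - a) / (b - a)) ^ 2
        + (6 * ((yb - ya) / (b - a)) - 2 * ma - 2 * mb)
          * ((1 - (x - a) / (b - a)) * ((x - a) / (b - a)))
        + mb * ((x - a) / (b - a)) ^ 2) x := by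
  have hba : b - a ≠ 0 := sub_ne_zero.2 hab.symm
  have ht : HasDerivAt (fun x : ℝ => (x - a) / (b - a)) (1 / (b - a)) x :=
    ((hasDerivAt_id x).sub_const a).div_const (b - a)
  have h2 := ht.fun_pow 2
  have h3 := ht.fun_pow 3
  have h := (((((h3.const_mul 2).fun_sub (h2.const_mul 3)).add_const 1).mul_const ya).fun_add
    (((((h3.fun_sub (h2.const_mul 2)).fun_add ht).mul_const (b - a)).mul_const ma))).fun_add
    (((h3.const_mul (-2)).fun_add (h2.const_mul 3)).mul_const yb) |>.fun_add
    (((h3.fun_sub h2).mul_const (b - a)).mul_const mb)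
  refine h.congr_deriv ?_
  generalize (x - a) / (b - a) = t
  push_cast
  field_simp
  ring

/-- Fritsch–Carlson sufficient conditions for decreasing monotonicity: if
`y_a > y_b`, `m_a ≤ 0`, `m_b ≤ 0` and `(m_a/d)² + (m_b/d)² ≤ 9`, where
`d = (y_b - y_a)/(b - a) < 0` is the secant slope, then the cubic Hermite
interpolant is monotonically decreasing on `[a,b]`. -/
theorem hermite_decreasing_sufficient (a b ya yb ma mb : ℝ) (hab : a < b)
    (hy : ya > yb)
    (hma : ma ≤ 0) (hmb : mb ≤ 0)
    (hsum : (ma / ((yb - ya) / (b - a))) ^ 2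
        + (mb / ((yb - ya) / (b - a))) ^ 2 ≤ 9) :
    ∀ x₁ ∈ Set.Icc a b, ∀ x₂ ∈ Set.Icc a b, x₁ ≤ x₂ →
      hermite a b ya yb ma mb x₁ ≥ hermite a b ya yb ma mb x₂ := by
  have hba : 0 < b - a := sub_pos.2 hab
  have hd : (yb - ya) / (b - a) < 0 := div_neg_of_neg_of_pos (sub_neg.2 hy) hba
  have hderiv := hasDerivAt_hermite hab.ne ya yb ma mb
  have hanti : AntitoneOn (hermite a b ya yb ma mb) (Set.Icc a b) := by
    refine antitoneOn_of_deriv_nonpos (convex_Icc a b)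
      (fun x _ => (hderiv x).continuousAt.continuousWithinAt)
      (fun x _ => (hderiv x).differentiableAt.differentiableWithinAt) fun x hx => ?_
    rw [interior_Icc] at hx
    rw [(hderiv x).deriv]
    have ht0 : 0 ≤ (x - a) / (b - a) := div_nonneg (sub_nonneg.2 hx.1.le) hba.le
    have ht1 : 0 ≤ 1 - (x - a) / (b - a) :=
      sub_nonneg.2 ((div_le_one hba).2 (by linarith [hx.2]))
    generalize (x - a) / (b - a) = t at ht0 ht1 ⊢
    generalize (yb - ya) / (b - a) = d at hd hsum ⊢
    have hq := mul_nonpos_of_nonpos_of_nonneg hd.le (fritschCarlson_quadratic_nonneg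
      (div_nonneg_of_nonpos hma hd.le) (div_nonneg_of_nonpos hmb hd.le) hsum ht1 ht0)
    have hmad : d * (ma / d) = ma := mul_div_cancel₀ _ hd.ne
    have hmbd : d * (mb / d) = mb := mul_div_cancel₀ _ hd.ne
    refine le_of_eq_of_le ?_ hq
    linear_combination (-(1 - t) ^ 2 + 2 * ((1 - t) * t)) * hmad
      + (-t ^ 2 + 2 * ((1 - t) * t)) * hmbd
  exact fun x₁ h₁ x₂ h₂ h => hanti h₁ h₂ h
end

section
/- For all real numbers α ≥ 0 and β ≥ 0 with α² + β² ≤ 9, and for all t ∈ [0,1], the inequality α·(3t² − 4t + 1) + β·(3t² − 2t) + 6t(1 − t) ≥ 0 holds. (This expression is the normalized derivative of the cubic Hermite interpolant: dividing p'(x) by the positive quantity d yields exactly this quadratic in t, so its nonnegativity on [0,1] gives the Fritsch–Carlson sufficient condition for monotonicity.) -/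
/-- Key pointwise inequality for the Fritsch–Carlson sufficient condition:
for `α, β ≥ 0` with `α² + β² ≤ 9` and `t ∈ [0,1]`, the normalized derivative
`α(3t² − 4t + 1) + β(3t² − 2t) + 6t(1 − t)` of the cubic Hermite interpolant
is nonnegative. -/
theorem normalized_hermite_deriv_nonneg (α β : ℝ) (hα : 0 ≤ α) (hβ : 0 ≤ β)
    (hsum : α ^ 2 + β ^ 2 ≤ 9) :
    ∀ t ∈ Set.Icc (0 : ℝ) 1,
      0 ≤ α * (3 * t ^ 2 - 4 * t + 1) + β * (3 * t ^ 2 - 2 * t)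
        + 6 * t * (1 - t) := by
  rintro t ⟨ht0, ht1⟩
  have hts : 0 ≤ t * (1 - t) := mul_nonneg ht0 (sub_nonneg.2 ht1)
  have hform : α * (3 * t ^ 2 - 4 * t + 1) + β * (3 * t ^ 2 - 2 * t) + 6 * t * (1 - t)
      = α * (1 - t) ^ 2 + β * t ^ 2 + 2 * (3 - (α + β)) * (t * (1 - t)) := by ring
  rw [hform]
  rcases le_or_gt (α + β) 3 with h | h
  · have := sub_nonneg.2 h
    positivity
  · have hα3 : α ≤ 3 := by nlinarith [sq_nonneg β]
    have hβ3 : β ≤ 3 := by nlinarith [sq_nonneg α]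
    have hα_pos : 0 < α := by linarith
    have hdisc : (α + β - 3) ^ 2 ≤ α * β := by
      nlinarith [mul_nonneg (sub_nonneg.2 h.le) (by linarith : 0 ≤ 9 - (α + β))]
    refine nonneg_of_mul_nonneg_right ?_ hα_pos
    nlinarith [sq_nonneg (α * (1 - t) - (α + β - 3) * t),
      mul_nonneg (sub_nonneg.2 hdisc) (sq_nonneg t)]
end

section
/- Let Φ₀ : ℝⁿ → ℝ^{n₁} be a KAN layer map whose j-th component is Φ₀_j(x) = Σ_{i=1}^{n} (ω_{j,i}·φ_{j,i}(x_i) + ν_{j,i}·b(x_i)) + θ_j, and let r ∈ {1,…,n}. Suppose that for every j: ω_{j,r} ≥ 0, ν_{j,r} ≥ 0, φ_{j,r} is increasingly monotonic on ℝ, and the basis function b is increasingly monotonic on ℝ. Let G : ℝ^{n₁} → ℝ be monotone with respect to the componentwise order on ℝ^{n₁}. Then the composition G ∘ Φ₀ : ℝⁿ → ℝ is increasingly partially monotonic with respect to its r-th input over all of ℝⁿ. -/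
/-- Composing a KAN layer `Φ₀ : ℝⁿ → ℝ^{n₁}` — whose `r`-th column has
nonnegative weights and increasingly monotonic `φ_{j,r}` and basis `b` —
with a map `G : ℝ^{n₁} → ℝ` that is monotone for the componentwise order
yields a function that is increasingly partially monotonic with respect to
its `r`-th input. -/
theorem kan_layer_comp_increasing_partial_monotone (n n₁ : ℕ) (r : Fin n)
    (φ : Fin n₁ → Fin n → ℝ → ℝ) (b : ℝ → ℝ)
    (ω ν : Fin n₁ → Fin n → ℝ) (θ : Fin n₁ → ℝ)
    (Φ₀ : (Fin n → ℝ) → (Fin n₁ → ℝ))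
    (hΦ₀ : ∀ (x : Fin n → ℝ) (j : Fin n₁),
      Φ₀ x j = (∑ i : Fin n, (ω j i * φ j i (x i) + ν j i * b (x i))) + θ j)
    (hω : ∀ j : Fin n₁, 0 ≤ ω j r)
    (hν : ∀ j : Fin n₁, 0 ≤ ν j r)
    (hφ : ∀ j : Fin n₁, ∀ x₁ x₂ : ℝ, x₁ ≤ x₂ → φ j r x₁ ≤ φ j r x₂)
    (hb : ∀ x₁ x₂ : ℝ, x₁ ≤ x₂ → b x₁ ≤ b x₂)
    (G : (Fin n₁ → ℝ) → ℝ)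
    (hG : ∀ u v : Fin n₁ → ℝ, u ≤ v → G u ≤ G v) :
    ∀ (x : Fin n → ℝ) (s t : ℝ), s ≤ t →
      (G ∘ Φ₀) (Function.update x r s) ≤ (G ∘ Φ₀) (Function.update x r t) := by
  intro x s t hst
  refine hG _ _ fun j => ?_
  rw [hΦ₀, hΦ₀]
  refine add_le_add_left (Finset.sum_le_sum fun i _ => ?_) _
  by_cases h : i = r
  · subst h
    simpa using add_le_add (mul_le_mul_of_nonneg_left (hφ j s t hst) (hω j))
      (mul_le_mul_of_nonneg_left (hb s t hst) (hν j))
  · simp [h]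
end

section
/- Let Φ₀ : ℝⁿ → ℝ^{n₁} be a KAN layer map whose j-th component is Φ₀_j(x) = Σ_{i=1}^{n} (ω_{j,i}·φ_{j,i}(x_i) + ν_{j,i}·b(x_i)) + θ_j, and let r ∈ {1,…,n}. Suppose that for every j: ω_{j,r} ≥ 0, ν_{j,r} ≤ 0, φ_{j,r} is decreasingly monotonic on ℝ, and the basis function b is increasingly monotonic on ℝ. Let G : ℝ^{n₁} → ℝ be monotone with respect to the componentwise order on ℝ^{n₁}. Then the composition G ∘ Φ₀ : ℝⁿ → ℝ is decreasingly partially monotonic with respect to its r-th input over all of ℝⁿ. -/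
/-- Composing a KAN layer `Φ₀ : ℝⁿ → ℝ^{n₁}` — whose `r`-th column has
`ω_{j,r} ≥ 0`, `ν_{j,r} ≤ 0`, decreasingly monotonic `φ_{j,r}` and
increasingly monotonic basis `b` — with a map `G : ℝ^{n₁} → ℝ` that is
monotone for the componentwise order yields a function that is decreasingly
partially monotonic with respect to its `r`-th input. -/
theorem kan_layer_comp_decreasing_partial_monotone (n n₁ : ℕ) (r : Fin n)
    (φ : Fin n₁ → Fin n → ℝ → ℝ) (b : ℝ → ℝ)
    (ω ν : Fin n₁ → Fin n → ℝ) (θ : Fin n₁ → ℝ)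
    (Φ₀ : (Fin n → ℝ) → (Fin n₁ → ℝ))
    (hΦ₀ : ∀ (x : Fin n → ℝ) (j : Fin n₁),
      Φ₀ x j = (∑ i : Fin n, (ω j i * φ j i (x i) + ν j i * b (x i))) + θ j)
    (hω : ∀ j : Fin n₁, 0 ≤ ω j r)
    (hν : ∀ j : Fin n₁, ν j r ≤ 0)
    (hφ : ∀ j : Fin n₁, ∀ x₁ x₂ : ℝ, x₁ ≤ x₂ → φ j r x₁ ≥ φ j r x₂)
    (hb : ∀ x₁ x₂ : ℝ, x₁ ≤ x₂ → b x₁ ≤ b x₂)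
    (G : (Fin n₁ → ℝ) → ℝ)
    (hG : ∀ u v : Fin n₁ → ℝ, u ≤ v → G u ≤ G v) :
    ∀ (x : Fin n → ℝ) (s t : ℝ), s ≤ t →
      (G ∘ Φ₀) (Function.update x r s) ≥ (G ∘ Φ₀) (Function.update x r t) := by
  intro x s t hst
  refine hG _ _ fun j => ?_
  rw [hΦ₀, hΦ₀]
  refine add_le_add_left (Finset.sum_le_sum fun i _ => ?_) _
  obtain rfl | hir := eq_or_ne i r
  · simp only [Function.update_self]
    exact add_le_add (mul_le_mul_of_nonneg_left (hφ j s t hst) (hω j))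
      (mul_le_mul_of_nonpos_left (hb s t hst) (hν j))
  · simp only [Function.update_of_ne hir, le_refl]
end

section
/- Let K ≥ 2 and let x¹ < x² < … < x^K be real knots with values y¹,…,y^K and derivative values m¹,…,m^K. Suppose for every segment k ∈ {1,…,K−1}, with secant slope d^k = (y^{k+1} − y^k)/(x^{k+1} − x^k): (i) y^k ≤ y^{k+1} (so d^k ≥ 0); (ii) if d^k = 0 then m^k = m^{k+1} = 0; (iii) if d^k > 0 then m^k ≥ 0, m^{k+1} ≥ 0, and (m^k/d^k)² + (m^{k+1}/d^k)² ≤ 9. Let s : ℝ → ℝ be the function that on each interval [x^k, x^{k+1}] equals the cubic Hermite interpolant of the data (x^k, y^k, m^k), (x^{k+1}, y^{k+1}, m^{k+1}), that equals y¹ + m¹·(x − x¹) for x ≤ x¹, and equals y^K + m^K·(x − x^K) for x ≥ x^K. Then s is monotonically increasing on all of ℝ. -/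
/-- A cubic Hermite interpolant whose endpoint slopes lie between `0` and three times the secant
slope is monotone on its interval. -/
theorem monotoneOn_hermite {a b ya yb ma mb : ℝ} (hab : a < b)
    (hma : 0 ≤ ma) (hmb : 0 ≤ mb)
    (hma' : (b - a) * ma ≤ 3 * (yb - ya)) (hmb' : (b - a) * mb ≤ 3 * (yb - ya)) :
    MonotoneOn (hermite a b ya yb ma mb) (Set.Icc a b) := by
  have hba : 0 < b - a := sub_pos.2 hab
  set A := (b - a) * ma with hA
  set B := (b - a) * mb with hB
  have hA0 : 0 ≤ A := mul_nonneg hba.le hma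
  have hB0 : 0 ≤ B := mul_nonneg hba.le hmb
  let q : ℝ → ℝ := fun t => (2 * t ^ 3 - 3 * t ^ 2 + 1) * ya + (t ^ 3 - 2 * t ^ 2 + t) * A
    + (-2 * t ^ 3 + 3 * t ^ 2) * yb + (t ^ 3 - t ^ 2) * B
  have hq (t : ℝ) : HasDerivAt q
      (6 * (t * (1 - t)) * (yb - ya) + (1 - t) * (1 - 3 * t) * A - t * (2 - 3 * t) * B) t := by
    have h2 := hasDerivAt_pow 2 t
    have h3 := hasDerivAt_pow 3 t
    have h := (((((h3.const_mul 2).sub (h2.const_mul 3)).add_const 1).mul_const ya).add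
      (((h3.sub (h2.const_mul 2)).add (hasDerivAt_id t)).mul_const A)).add
      (((h3.const_mul (-2)).add (h2.const_mul 3)).mul_const yb) |>.add
      ((h3.sub h2).mul_const B)
    refine h.congr_deriv ?_
    push_cast
    ring
  have hmono : MonotoneOn q (Set.Icc 0 1) := by
    refine monotoneOn_of_deriv_nonneg (convex_Icc 0 1)
      (fun t _ => (hq t).continuousAt.continuousWithinAt)
      (fun t _ => (hq t).differentiableAt.differentiableWithinAt) fun t ht => ?_
    rw [interior_Icc] at ht
    obtain ⟨h0, h1⟩ := ht
    rw [(hq t).deriv]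
    have hD : 0 ≤ yb - ya := by linarith
    have h1' : 0 ≤ 1 - t := by linarith
    rcases le_total (3 * t) 1 with h | h
    · have e1 := mul_nonneg (mul_nonneg h1' (sub_nonneg.2 h)) hA0
      have e2 := mul_nonneg (mul_nonneg h0.le (by linarith : 0 ≤ 2 - 3 * t)) (sub_nonneg.2 hmb')
      have e3 := mul_nonneg (mul_nonneg h0.le h0.le) hD
      linarith
    · rcases le_total (3 * t) 2 with h' | h'
      · have e1 := mul_nonneg (mul_nonneg h1' (sub_nonneg.2 h)) (sub_nonneg.2 hma')
        have e2 := mul_nonneg (mul_nonneg h0.le (sub_nonneg.2 h')) (sub_nonneg.2 hmb')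
        have e3 := mul_nonneg (sq_nonneg (1 - 2 * t)) hD
        linarith
      · have e1 := mul_nonneg (mul_nonneg h1' (sub_nonneg.2 h)) (sub_nonneg.2 hma')
        have e2 := mul_nonneg (mul_nonneg h0.le (sub_nonneg.2 h')) hB0
        have e3 := mul_nonneg (mul_nonneg h1' h1') hD
        linarith
  have hmem {u : ℝ} (hu : u ∈ Set.Icc a b) : (u - a) / (b - a) ∈ Set.Icc (0 : ℝ) 1 :=
    ⟨div_nonneg (sub_nonneg.2 hu.1) hba.le, (div_le_one hba).2 (by linarith [hu.2])⟩
  have heq (u : ℝ) : hermite a b ya yb ma mb u = q ((u - a) / (b - a)) := by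
    simp only [hermite, q, hA, hB]
    ring
  intro u hu v hv huv
  rw [heq, heq]
  exact hmono (hmem hu) (hmem hv) (by gcongr)

/-- A cubic Hermite spline on knots `x⁰ < x¹ < … < x^{K-1}` (here indexed from
`0`) whose every segment satisfies the Fritsch–Carlson monotonicity
conditions, extended linearly outside `[x⁰, x^{K-1}]` with slopes `m⁰` and
`m^{K-1}`, is monotonically increasing on all of `ℝ`. -/
theorem hermite_spline_monotone (K : ℕ) (hK : 2 ≤ K) (x y m : ℕ → ℝ)
    (hx : ∀ k : ℕ, k + 1 < K → x k < x (k + 1))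
    (hy : ∀ k : ℕ, k + 1 < K → y k ≤ y (k + 1))
    (hd0 : ∀ k : ℕ, k + 1 < K →
      (y (k + 1) - y k) / (x (k + 1) - x k) = 0 → m k = 0 ∧ m (k + 1) = 0)
    (hdpos : ∀ k : ℕ, k + 1 < K →
      0 < (y (k + 1) - y k) / (x (k + 1) - x k) →
      0 ≤ m k ∧ 0 ≤ m (k + 1) ∧
        (m k / ((y (k + 1) - y k) / (x (k + 1) - x k))) ^ 2
          + (m (k + 1) / ((y (k + 1) - y k) / (x (k + 1) - x k))) ^ 2 ≤ 9)
    (s : ℝ → ℝ)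
    (hseg : ∀ k : ℕ, k + 1 < K → ∀ t ∈ Set.Icc (x k) (x (k + 1)),
      s t = hermite (x k) (x (k + 1)) (y k) (y (k + 1)) (m k) (m (k + 1)) t)
    (hleft : ∀ t : ℝ, t ≤ x 0 → s t = y 0 + m 0 * (t - x 0))
    (hright : ∀ t : ℝ, x (K - 1) ≤ t → s t = y (K - 1) + m (K - 1) * (t - x (K - 1))) :
    Monotone s := by
  have hm : ∀ k : ℕ, k + 1 < K → 0 ≤ m k ∧ 0 ≤ m (k + 1) ∧
      (x (k + 1) - x k) * m k ≤ 3 * (y (k + 1) - y k) ∧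
      (x (k + 1) - x k) * m (k + 1) ≤ 3 * (y (k + 1) - y k) := by
    intro k hk
    have hw : 0 < x (k + 1) - x k := sub_pos.2 (hx k hk)
    have hr : 0 ≤ y (k + 1) - y k := sub_nonneg.2 (hy k hk)
    rcases (div_nonneg hr hw.le).eq_or_lt with hd | hd
    · obtain ⟨h1, h2⟩ := hd0 k hk hd.symm
      simp only [h1, h2, mul_zero]
      exact ⟨le_rfl, le_rfl, by linarith, by linarith⟩
    · obtain ⟨h1, h2, h3⟩ := hdpos k hk hd
      have key {c e : ℝ} (h : (c / ((y (k + 1) - y k) / (x (k + 1) - x k))) ^ 2 + e ^ 2 ≤ 9) :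
          (x (k + 1) - x k) * c ≤ 3 * (y (k + 1) - y k) := by
        have h4 : c / ((y (k + 1) - y k) / (x (k + 1) - x k)) ≤ 3 :=
          abs_le_of_sq_le_sq' (by nlinarith [sq_nonneg e]) (by norm_num) |>.2
        rw [div_le_iff₀ hd, mul_div_assoc', le_div_iff₀ hw] at h4
        linarith
      exact ⟨h1, h2, key h3, key (by rwa [add_comm] at h3)⟩
  have hIic : ∀ k : ℕ, k < K → MonotoneOn s (Set.Iic (x k)) := by
    intro k
    induction k with
    | zero =>
      intro _ u hu v hv huv
      rw [hleft u hu, hleft v hv]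
      have := (hm 0 hK).1
      gcongr
    | succ k ih =>
      intro hk
      have hle := (hx k hk).le
      obtain ⟨h1, h2, h3, h4⟩ := hm k hk
      have hIcc : MonotoneOn s (Set.Icc (x k) (x (k + 1))) :=
        (monotoneOn_hermite (hx k hk) h1 h2 h3 h4).congr fun t ht => (hseg k hk t ht).symm
      rw [← Set.Iic_union_Icc_eq_Iic hle]
      exact (ih (by omega)).union_right hIcc isGreatest_Iic (isLeast_Icc hle)
  refine (hIic (K - 1) (by omega)).Iic_union_Ici fun u hu v hv huv => ?_
  rw [hright u hu, hright v hv]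
  have hlast : 0 ≤ m (K - 1) := by
    have h := (hm (K - 2) (by omega)).2.1
    rwa [show K - 2 + 1 = K - 1 by omega] at h
  gcongr
end
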